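/- Let q be an odd prime power, ζ a primitive (q+1)-th root of unity in F_{q^2}, and v_k = η for k even, v_k = 1 for k odd where η^(q+1) = −1. For integers e, e' with 0 ≤ e, e' ≤ (q−1)/2, the sum ∑_{k=0}^{q} v_k^{q+1} ζ^{k(e+qe')} equals 0 if and only if e ≢ e' (mod (q+1)/2), i.e. (since |e−e'| ≤ (q−1)/2 < (q+1)/2) if and only if e ≠ e'... Correction: the sum equals 0 if either e ≡ e' (mod q+1) or e ≢ e' (mod (q+1)/2); in the range 0 ≤ e, e' ≤ (q−1)/2 this holds for all e, e'. Hence the sum is always 0 for such e, e'. -/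

import Mathlib

theorem sum_range_two_mul_alternating {R : Type*} [CommRing R] (x : R) (m : ℕ) :
    ∑ k ∈ Finset.range (2 * m), (if Even k then (-1 : R) else 1) * x ^ k =
      (x - 1) * ∑ j ∈ Finset.range m, (x ^ 2) ^ j := by
  induction m with
  | zero => simp
  | succ m ih =>
    have h_odd : ¬ Even (2 * m + 1) := by simp [parity_simps]
    rw [show 2 * (m + 1) = 2 * m + 1 + 1 by ring, Finset.sum_range_succ, Finset.sum_range_succ,
      ih, Finset.sum_range_succ _ m, if_pos (even_two_mul m), if_neg h_odd]
    ring

theorem stmt_11 (q : ℕ) (hq : ∃ (p k : ℕ), p.Prime ∧ Odd p ∧ 0 < k ∧ q = p ^ k)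
    (F : Type*) [Field F] [Fintype F]
    (hF : Fintype.card F = q ^ 2)
    (ζ : F) (hζ : orderOf ζ = q + 1)
    (η : F) (hη : η ^ (q + 1) = -1)
    (e e' : ℕ) (he : e ≤ (q - 1) / 2) (he' : e' ≤ (q - 1) / 2) :
    ∑ k ∈ Finset.range (q + 1),
        (if Even k then η else 1) ^ (q + 1) * ζ ^ (k * (e + q * e')) = 0 := by
  obtain ⟨m, hm⟩ : ∃ m, q + 1 = 2 * m := by
    obtain ⟨p, k, -, hp, -, rfl⟩ := hq
    obtain ⟨n, hn⟩ := hp.pow (n := k)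
    exact ⟨n + 1, by omega⟩
  have h_one : ζ ^ (q + 1) = 1 := hζ ▸ pow_orderOf_eq_one ζ
  set x := ζ ^ (e + q * e') with hx
  have h_sum : ∑ k ∈ Finset.range (q + 1),
      (if Even k then η else 1) ^ (q + 1) * ζ ^ (k * (e + q * e')) =
      (x - 1) * ∑ j ∈ Finset.range m, (x ^ 2) ^ j := by
    rw [← sum_range_two_mul_alternating, ← hm]
    refine Finset.sum_congr rfl fun k _ => ?_
    rw [ite_pow, hη, one_pow, hx, ← pow_mul, mul_comm k]
  rw [h_sum]
  by_cases h : e = e'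
  · have h_x : x = 1 := by
      rw [hx, h, show e' + q * e' = (q + 1) * e' by ring, pow_mul, h_one, one_pow]
    rw [h_x, sub_self, zero_mul]
  · have h_sq : x ^ 2 - 1 ≠ 0 := by
      intro h_eq
      have h_dvd : 2 * m ∣ 2 * (e + q * e') := by
        rw [← hm, ← hζ, mul_comm 2]
        exact orderOf_dvd_of_pow_eq_one (by rw [pow_mul, ← hx]; exact sub_eq_zero.mp h_eq)
      have h_dvd' : (m : ℤ) ∣ e + q * e' := by
        exact_mod_cast Nat.dvd_of_mul_dvd_mul_left two_pos h_dvd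
      have hm' : (q : ℤ) + 1 = 2 * m := by exact_mod_cast hm
      have h_diff : (m : ℤ) ∣ e - e' := by
        have h_eq' : (e : ℤ) - e' = (e + q * e') - m * (2 * e') := by
          linear_combination (-(e' : ℤ)) * hm'
        rw [h_eq']
        exact dvd_sub h_dvd' (dvd_mul_right _ _)
      have h_zero := Int.eq_zero_of_abs_lt_dvd h_diff (by rw [abs_lt]; omega)
      omega
    have h_geom : (x ^ 2 - 1) * ∑ j ∈ Finset.range m, (x ^ 2) ^ j = 0 := by
      rw [mul_geom_sum, ← pow_mul, ← hm, hx, pow_right_comm, h_one, one_pow, sub_self]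
    rw [(mul_eq_zero.mp h_geom).resolve_left h_sq, mul_zero]
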